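/- (DCGD+ convergence.) Let f_1, …, f_n : ℝ^d → ℝ be differentiable, convex, bounded below and L_i-smooth for symmetric positive semidefinite matrices L_i; let f = (1/n) Σ_i f_i be 𝐋-smooth for a symmetric PSD matrix 𝐋 with L = λmax(𝐋), and μ-strongly convex with μ > 0. Let R : ℝ^d → ℝ ∪ {+∞} be proper, convex and lower semicontinuous, and x* a minimizer of f + R. Each node i has a proper sampling S_i with matrices P̃_i and sketch C_i; set L̃_i = λmax(P̃_i ∘ L_i) and L̃max = max_i L̃_i. Define random iterates by a fixed x^0, g^k = (1/n) Σ_{i=1}^n L_i^{1/2} C_i^k L_i^{†1/2} ∇f_i(x^k) and x^{k+1} = prox_{γR}(x^k − γ g^k), where the sketches {C_i^k : i ∈ [n], k ≥ 0} are mutually independent with C_i^k distributed as the sketch of S_i, and prox_{γR}(z) is the unique minimizer of u ↦ γR(u) + ½‖u−z‖². If 0 < γ ≤ 1/(L + (2/n) L̃max), then for every k ≥ 0, E[‖x^k − x*‖²] ≤ (1 − γμ)^k ‖x^0 − x*‖² + 2γσ*/(μ n), where σ* = (1/n) Σ_{i=1}^n L̃_i ‖∇f_i(x*)‖²_{L_i†}.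 -/

import Mathlib

open scoped BigOperators RealInnerProductSpace
open Matrix

noncomputable section

/-- A proper sampling on `{1,…,d}`: a finitely supported probability distribution over
subsets of `Fin d` whose marginal probabilities are all positive. -/
structure Sampling (d : ℕ) where
  prob : Finset (Fin d) → ℝ
  nonneg : ∀ S, 0 ≤ prob S
  total : ∑ S : Finset (Fin d), prob S = 1
  margPos : ∀ j : Fin d, 0 < ∑ S : Finset (Fin d), if j ∈ S then prob S else 0

namespace Sampling

variable {d : ℕ} (μ : Sampling d)

/-- Marginal probability `p_j = Prob(j ∈ S)`. -/
def marg (j : Fin d) : ℝ := ∑ S : Finset (Fin d), if j ∈ S then μ.prob S else 0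

/-- Probability matrix `P`, with entries `p_{jl} = Prob({j,l} ⊆ S)`. -/
def probMatrix : Matrix (Fin d) (Fin d) ℝ :=
  Matrix.of fun j l => ∑ S : Finset (Fin d), if j ∈ S ∧ l ∈ S then μ.prob S else 0

/-- The matrix `P̄` with entries `p_{jl}/(p_j p_l)`. -/
def Pbar : Matrix (Fin d) (Fin d) ℝ :=
  Matrix.of fun j l => μ.probMatrix j l / (μ.marg j * μ.marg l)

/-- The matrix `P̃ = P̄ − E` where `E` is the all-ones matrix. -/
def Ptilde : Matrix (Fin d) (Fin d) ℝ := μ.Pbar - Matrix.of fun _ _ => (1 : ℝ)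

/-- The unbiased diagonal sketch `C` associated with a realization `S` of the sampling. -/
def sketch (S : Finset (Fin d)) : Matrix (Fin d) (Fin d) ℝ :=
  Matrix.diagonal fun j => if j ∈ S then (μ.marg j)⁻¹ else 0

end Sampling

/-- Largest eigenvalue of a symmetric matrix, via the Rayleigh quotient. -/
def lambdaMax {d : ℕ} (M : Matrix (Fin d) (Fin d) ℝ) : ℝ :=
  sSup {r : ℝ | ∃ v : Fin d → ℝ, v ⬝ᵥ v = 1 ∧ r = v ⬝ᵥ M.mulVec v}

/-- Smallest eigenvalue of a symmetric matrix, via the Rayleigh quotient. -/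
def lambdaMin {d : ℕ} (M : Matrix (Fin d) (Fin d) ℝ) : ℝ :=
  sInf {r : ℝ | ∃ v : Fin d → ℝ, v ⬝ᵥ v = 1 ∧ r = v ⬝ᵥ M.mulVec v}

/-- `Mdag` is the Moore–Penrose pseudoinverse of `M`. -/
def IsMoorePenrose {m n : Type*} [Fintype m] [Fintype n]
    (M : Matrix m n ℝ) (Mdag : Matrix n m ℝ) : Prop :=
  M * Mdag * M = M ∧ Mdag * M * Mdag = Mdag ∧
    (M * Mdag)ᵀ = M * Mdag ∧ (Mdag * M)ᵀ = Mdag * M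

/-- Vectors in `ℝ^d` with the Euclidean inner product. -/
abbrev Vec (d : ℕ) := EuclideanSpace ℝ (Fin d)

/-- Action of a matrix on a Euclidean vector. -/
def mact {d e : ℕ} (M : Matrix (Fin e) (Fin d) ℝ) (x : Vec d) : Vec e :=
  Matrix.toEuclideanLin M x

/-- Quadratic form `xᵀ M x`, i.e. the squared `M`-seminorm `‖x‖²_M`. -/
def quad {d : ℕ} (M : Matrix (Fin d) (Fin d) ℝ) (x : Vec d) : ℝ := ⟪x, mact M x⟫

/-- `f` is `M`-smooth: `f x ≤ f y + ⟨∇f(y), x−y⟩ + ½ (x−y)ᵀ M (x−y)` for all `x, y`. -/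
def MSmooth {d : ℕ} (f : Vec d → ℝ) (M : Matrix (Fin d) (Fin d) ℝ) : Prop :=
  ∀ x y : Vec d, f x ≤ f y + ⟪gradient f y, x - y⟫ + (1 / 2) * quad M (x - y)

/-- Random iterates driven by i.i.d. draws: `traj x0 step k ω` is the `k`-th iterate along
the sample path `ω` of `k` draws. -/
def traj {V Ω : Type*} (x0 : V) (step : V → Ω → V) : ∀ k : ℕ, (Fin k → Ω) → V
  | 0, _ => x0
  | k + 1, ω => step (traj x0 step k fun i => ω i.castSucc) (ω (Fin.last k))

/-- Expectation `E[φ(x^k)]` of a functional of the `k`-th iterate, over `k` i.i.d. draws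
with one-step distribution `P`. -/
def trajExp {V Ω : Type*} [Fintype Ω] (P : Ω → ℝ) (x0 : V) (step : V → Ω → V)
    (φ : V → ℝ) (k : ℕ) : ℝ :=
  ∑ ω : Fin k → Ω, (∏ i, P (ω i)) * φ (traj x0 step k ω)


/-- `u` is the unique minimizer of `w ↦ γ R(w) + ½‖w − z‖²` (the proximal point of `z`). -/
def IsProxPt {d : ℕ} (R : Vec d → EReal) (γ : ℝ) (z u : Vec d) : Prop :=
  (∀ w : Vec d,
      (γ : EReal) * R u + ((1 / 2 * ‖u - z‖ ^ 2 : ℝ) : EReal)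
        ≤ (γ : EReal) * R w + ((1 / 2 * ‖w - z‖ ^ 2 : ℝ) : EReal)) ∧
  ∀ w : Vec d,
    (∀ w' : Vec d,
        (γ : EReal) * R w + ((1 / 2 * ‖w - z‖ ^ 2 : ℝ) : EReal)
          ≤ (γ : EReal) * R w' + ((1 / 2 * ‖w' - z‖ ^ 2 : ℝ) : EReal)) →
    w = u

/-- `R : ℝ^d → ℝ ∪ {+∞}` is proper, convex and lower semicontinuous. -/
def ProperConvexLsc {d : ℕ} (R : Vec d → EReal) : Prop :=
  (∀ x, R x ≠ ⊥) ∧ (∃ x, R x ≠ ⊤) ∧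
  (∀ x y : Vec d, ∀ a b : ℝ, 0 ≤ a → 0 ≤ b → a + b = 1 →
      R (a • x + b • y) ≤ (a : EReal) * R x + (b : EReal) * R y) ∧
  LowerSemicontinuous R

section MatrixAction

variable {d : ℕ}

lemma mact_mul (M N : Matrix (Fin d) (Fin d) ℝ) (x : Vec d) :
    mact (M * N) x = mact M (mact N x) := by
  simp [mact, Matrix.toLpLin_apply, Matrix.mulVec_mulVec]

lemma mact_one (x : Vec d) : mact (1 : Matrix (Fin d) (Fin d) ℝ) x = x := by
  simp [mact]

lemma mact_sub_left (M N : Matrix (Fin d) (Fin d) ℝ) (x : Vec d) :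
    mact (M - N) x = mact M x - mact N x := by
  simp [mact]

lemma mact_sub (M : Matrix (Fin d) (Fin d) ℝ) (x y : Vec d) :
    mact M (x - y) = mact M x - mact M y := by
  simp [mact]

lemma mact_smul (M : Matrix (Fin d) (Fin d) ℝ) (c : ℝ) (x : Vec d) :
    mact M (c • x) = c • mact M x := by
  simp [mact]

lemma inner_mact_right (M : Matrix (Fin d) (Fin d) ℝ) (x y : Vec d) :
    ⟪x, mact M y⟫ = ⟪mact Mᵀ x, y⟫ := by
  simp only [mact, Matrix.toLpLin_apply, EuclideanSpace.inner_eq_star_dotProduct, star_trivial,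
    Matrix.mulVec_transpose]
  rw [dotProduct_comm, Matrix.dotProduct_mulVec, dotProduct_comm]

lemma quad_eq_dotProduct (M : Matrix (Fin d) (Fin d) ℝ) (x : Vec d) :
    quad M x = x.ofLp ⬝ᵥ M *ᵥ x.ofLp := by
  simp only [quad, mact, Matrix.toLpLin_apply, EuclideanSpace.inner_eq_star_dotProduct,
    star_trivial]
  rw [dotProduct_comm]

lemma quad_smul (M : Matrix (Fin d) (Fin d) ℝ) (c : ℝ) (x : Vec d) :
    quad M (c • x) = c ^ 2 * quad M x := by
  simp only [quad, mact_smul, inner_smul_left, inner_smul_right, conj_trivial]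
  ring

lemma transpose_eq_of_posSemidef {M : Matrix (Fin d) (Fin d) ℝ} (h : M.PosSemidef) : Mᵀ = M := by
  simpa using h.isHermitian.eq

lemma quad_mul_self {S : Matrix (Fin d) (Fin d) ℝ} (h : S.PosSemidef) (x : Vec d) :
    quad (S * S) x = ‖mact S x‖ ^ 2 := by
  rw [quad, mact_mul, inner_mact_right, transpose_eq_of_posSemidef h, real_inner_self_eq_norm_sq]

lemma quad_sub_le_of_mul_self {S M : Matrix (Fin d) (Fin d) ℝ} (h : S.PosSemidef ∧ S * S = M)
    (x y : Vec d) : quad M x ≤ 2 * quad M (x - y) + 2 * quad M y := by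
  rw [← h.2, quad_mul_self h.1, quad_mul_self h.1, quad_mul_self h.1]
  have h1 : mact S x = mact S (x - y) + mact S y := by rw [mact_sub]; abel
  have h2 := parallelogram_law_with_norm ℝ (mact S (x - y)) (mact S y)
  rw [h1]
  nlinarith [sq_nonneg ‖mact S (x - y) - mact S y‖]

end MatrixAction

section RayleighQuotient

variable {d : ℕ}

lemma bddAbove_rayleigh (M : Matrix (Fin d) (Fin d) ℝ) :
    BddAbove {r : ℝ | ∃ v : Fin d → ℝ, v ⬝ᵥ v = 1 ∧ r = v ⬝ᵥ M.mulVec v} := by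
  refine ⟨∑ i, ∑ j, |M i j|, ?_⟩
  rintro r ⟨v, hv, rfl⟩
  have hle : ∀ i, |v i| ≤ 1 := fun i => by
    have : v i * v i ≤ v ⬝ᵥ v :=
      Finset.single_le_sum (f := fun i => v i * v i) (fun i _ => mul_self_nonneg _)
        (Finset.mem_univ i)
    exact abs_le_one_iff_mul_self_le_one.2 (hv ▸ this)
  simp only [dotProduct, Matrix.mulVec, Finset.mul_sum]
  refine Finset.sum_le_sum fun i _ => Finset.sum_le_sum fun j _ => ?_
  refine (le_abs_self _).trans ?_
  rw [abs_mul, abs_mul]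
  calc |v i| * (|M i j| * |v j|) ≤ 1 * (|M i j| * 1) := by
        gcongr
        · exact hle i
        · exact hle j
    _ = |M i j| := by ring

lemma quad_le_lambdaMax (M : Matrix (Fin d) (Fin d) ℝ) (x : Vec d) :
    quad M x ≤ lambdaMax M * ‖x‖ ^ 2 := by
  by_cases hx : x = 0
  · simp [hx, quad]
  have hn : 0 < ‖x‖ := norm_pos_iff.2 hx
  set u : Vec d := ‖x‖⁻¹ • x with hu
  have hu1 : ‖u‖ = 1 := by simp [hu, norm_smul, hn.ne']
  have hle : quad M u ≤ lambdaMax M := by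
    refine le_csSup (bddAbove_rayleigh M) ⟨u.ofLp, ?_, quad_eq_dotProduct M u⟩
    have : ⟪u, u⟫ = 1 := by rw [real_inner_self_eq_norm_sq, hu1]; norm_num
    rw [EuclideanSpace.inner_eq_star_dotProduct] at this
    simpa only [star_trivial] using this
  have hxu : x = ‖x‖ • u := by simp [hu, smul_smul, hn.ne']
  rw [hxu, quad_smul, norm_smul, hu1, norm_norm, mul_one]
  nlinarith [sq_nonneg ‖x‖]

lemma lambdaMax_nonneg {M : Matrix (Fin d) (Fin d) ℝ} (h : ∀ x : Vec d, 0 ≤ quad M x) :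
    0 ≤ lambdaMax M := by
  refine Real.sSup_nonneg ?_
  rintro r ⟨v, -, rfl⟩
  simpa [quad_eq_dotProduct] using h (WithLp.toLp 2 v)

lemma quad_nonneg {M : Matrix (Fin d) (Fin d) ℝ} (h : M.PosSemidef) (x : Vec d) :
    0 ≤ quad M x := by
  rw [quad_eq_dotProduct]
  simpa using h.dotProduct_mulVec_nonneg x.ofLp

end RayleighQuotient

section Pseudoinverse

variable {d : ℕ}

open scoped MatrixOrder Matrix.Norms.L2Operator in
lemma Matrix.PosSemidef.eq_of_mul_self_eq {A B : Matrix (Fin d) (Fin d) ℝ} (hA : A.PosSemidef)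
    (hB : B.PosSemidef) (h : A * A = B * B) : A = B :=
  (CFC.mul_self_eq_mul_self_iff A B hA.nonneg hB.nonneg).1 h

lemma eq_mul_of_mul_self_eq {S L P : Matrix (Fin d) (Fin d) ℝ} (hS : Sᵀ = S) (hSS : S * S = L)
    (hP : Pᵀ = P) (hPL : P * L = L) : P * S = S := by
  have h : (S - P * S) * (S - P * S)ᴴ = 0 := by
    rw [Matrix.conjTranspose_eq_transpose_of_trivial, Matrix.transpose_sub,
      Matrix.transpose_mul, hS, hP]
    have : (S - P * S) * (S - S * P) = (S * S - P * (S * S)) - (S * S - P * (S * S)) * P := by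
      noncomm_ring
    rw [this, hSS, hPL]
    simp
  exact (sub_eq_zero.1 (Matrix.self_mul_conjTranspose_eq_zero.1 h)).symm

lemma sqrt_mul_sqrt_pinv {L S D T : Matrix (Fin d) (Fin d) ℝ}
    (hS : S.PosSemidef ∧ S * S = L) (hD : IsMoorePenrose L D) (hT : T.PosSemidef ∧ T * T = D) :
    S * T = L * D := by
  obtain ⟨h1, h2, h3, h4⟩ := hD
  have hSt := transpose_eq_of_posSemidef hS.1
  have hTt := transpose_eq_of_posSemidef hT.1
  have hLt : Lᵀ = L := by rw [← hS.2, Matrix.transpose_mul, hSt]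
  have hDt : Dᵀ = D := by rw [← hT.2, Matrix.transpose_mul, hTt]
  have hcomm : L * D = D * L := by
    rw [← h3, Matrix.transpose_mul, hLt, hDt]
  have hPS : L * D * S = S := eq_mul_of_mul_self_eq hSt hS.2 h3 h1
  have hSP : S * (L * D) = S := by
    have := congrArg Matrix.transpose hPS
    rwa [Matrix.transpose_mul, h3, hSt] at this
  have hSL : S * L = L * S := by rw [← hS.2, Matrix.mul_assoc]
  have hDS : D * S = S * D := by
    calc D * S = D * (S * (L * D)) := by rw [hSP]
      _ = D * (S * L) * D := by noncomm_ring
      _ = D * L * S * D := by rw [hSL]; noncomm_ring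
      _ = S * D := by rw [← hcomm, hPS]
  have hKpsd : (D * S).PosSemidef := by
    have h5 : (S * S * Sᴴ).PosSemidef := by
      simpa [Matrix.mul_assoc] using hS.1.mul_mul_conjTranspose_same S
    have h6 := h5.mul_mul_conjTranspose_same D
    have h7 : D * (S * S * Sᴴ) * Dᴴ = D * S := by
      simp only [Matrix.conjTranspose_eq_transpose_of_trivial, hSt, hDt]
      calc D * (S * S * S) * D = D * (S * S) * (S * D) := by noncomm_ring
        _ = D * L * D * S := by rw [hS.2, ← hDS]; noncomm_ring
        _ = D * S := by rw [h2]
    rwa [h7] at h6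
  have hKT : D * S = T := by
    refine hKpsd.eq_of_mul_self_eq hT.1 ?_
    rw [hT.2]
    calc D * S * (D * S) = D * S * (S * D) := by rw [hDS]
      _ = D * (S * S) * D := by noncomm_ring
      _ = D := by rw [hS.2, h2]
  rw [← hKT, hDS, ← Matrix.mul_assoc, hS.2]

end Pseudoinverse

section Smooth

variable {d : ℕ}

lemma ConvexOn.add_inner_gradient_le {φ : Vec d → ℝ} (hφ : ConvexOn ℝ Set.univ φ)
    (hd : Differentiable ℝ φ) (x y : Vec d) : φ y + ⟪gradient φ y, x - y⟫ ≤ φ x := by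
  have hline : ConvexOn ℝ Set.univ (φ ∘ AffineMap.lineMap (k := ℝ) y x) := by
    simpa using hφ.comp_affineMap (AffineMap.lineMap (k := ℝ) y x)
  have hderiv : HasDerivAt (φ ∘ AffineMap.lineMap (k := ℝ) y x) ⟪gradient φ y, x - y⟫ 0 := by
    have h1 : HasDerivAt (AffineMap.lineMap (k := ℝ) y x) (x - y) (0 : ℝ) :=
      AffineMap.hasDerivAt_lineMap
    have h2 : HasFDerivAt φ (fderiv ℝ φ y) (AffineMap.lineMap (k := ℝ) y x 0) := by
      simpa using (hd y).hasFDerivAt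
    simpa [inner_gradient_left] using h2.comp_hasDerivAt (0 : ℝ) h1
  have h := hline.le_slope_of_hasDerivAt (Set.mem_univ 0) (Set.mem_univ 1) one_pos hderiv
  simp only [slope_def_field, Function.comp_apply, AffineMap.lineMap_apply_one,
    AffineMap.lineMap_apply_zero, sub_zero, div_one] at h
  linarith

/-- The Bregman divergence of `φ` from `y` to `x`. -/
def bregman (φ : Vec d → ℝ) (x y : Vec d) : ℝ := φ x - φ y - ⟪gradient φ y, x - y⟫

lemma MSmooth.inner_sub_le_bregman {φ : Vec d → ℝ} {M : Matrix (Fin d) (Fin d) ℝ}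
    (hM : MSmooth φ M) (hφ : ∀ x y, φ y + ⟪gradient φ y, x - y⟫ ≤ φ x) (x y v : Vec d) :
    ⟪gradient φ x - gradient φ y, v⟫ - 1 / 2 * quad M v ≤ bregman φ x y := by
  have h1 := hM (x - v) x
  have h2 := hφ (x - v) y
  have e1 : x - v - x = (-1 : ℝ) • v := by simp
  have e2 : x - v - y = (x - y) - v := by abel
  rw [e1, quad_smul, inner_smul_right] at h1
  rw [e2, inner_sub_right] at h2
  rw [bregman, inner_sub_left]
  linarith

lemma MSmooth.quad_pinv_le_bregman {φ : Vec d → ℝ} {M D : Matrix (Fin d) (Fin d) ℝ}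
    (hM : MSmooth φ M) (hφ : ∀ x y, φ y + ⟪gradient φ y, x - y⟫ ≤ φ x)
    (hD : D * M * D = D) (hDt : Dᵀ = D) (x y : Vec d) :
    quad D (gradient φ x - gradient φ y) ≤ 2 * bregman φ x y := by
  set δ := gradient φ x - gradient φ y with hδ
  have h := hM.inner_sub_le_bregman hφ x y (mact D δ)
  have hq : quad M (mact D δ) = quad D δ := by
    nth_rw 1 [← hDt]
    rw [quad, ← inner_mact_right, hDt, ← mact_mul, ← mact_mul, hD, quad]
  rw [hq, ← hδ, ← quad] at h
  linarith

lemma MSmooth.norm_sq_le_bregman {φ : Vec d → ℝ} {M : Matrix (Fin d) (Fin d) ℝ}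
    (hM : MSmooth φ M) (hφ : ∀ x y, φ y + ⟪gradient φ y, x - y⟫ ≤ φ x)
    (hpos : 0 < lambdaMax M) (x y : Vec d) :
    ‖gradient φ x - gradient φ y‖ ^ 2 ≤ 2 * lambdaMax M * bregman φ x y := by
  set δ := gradient φ x - gradient φ y with hδ
  have h := hM.inner_sub_le_bregman hφ x y ((lambdaMax M)⁻¹ • δ)
  have hq := quad_le_lambdaMax M δ
  rw [quad_smul, inner_smul_right, ← hδ, real_inner_self_eq_norm_sq] at h
  have h2 : (lambdaMax M)⁻¹ ^ 2 * quad M δ ≤ (lambdaMax M)⁻¹ * ‖δ‖ ^ 2 := by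
    calc (lambdaMax M)⁻¹ ^ 2 * quad M δ ≤ (lambdaMax M)⁻¹ ^ 2 * (lambdaMax M * ‖δ‖ ^ 2) := by
          gcongr
      _ = (lambdaMax M)⁻¹ * ‖δ‖ ^ 2 := by field_simp
  have h3 : (lambdaMax M)⁻¹ * ‖δ‖ ^ 2 ≤ 2 * bregman φ x y := by linarith
  calc ‖δ‖ ^ 2 = lambdaMax M * ((lambdaMax M)⁻¹ * ‖δ‖ ^ 2) := by field_simp
    _ ≤ lambdaMax M * (2 * bregman φ x y) := by gcongr
    _ = _ := by ring

lemma MSmooth.inner_gradient_eq_zero {φ : Vec d → ℝ} {M : Matrix (Fin d) (Fin d) ℝ}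
    (hM : MSmooth φ M) (hb : BddBelow (Set.range φ)) (x : Vec d) {e : Vec d}
    (he : mact M e = 0) : ⟪gradient φ x, e⟫ = 0 := by
  obtain ⟨b, hb⟩ := hb
  by_contra hne
  set c := ⟪gradient φ x, e⟫ with hc
  have h := hM (x + ((b - φ x - 1) / c) • e) x
  have h1 := hb (Set.mem_range_self (x + ((b - φ x - 1) / c) • e))
  rw [add_sub_cancel_left, quad_smul, inner_smul_right, ← hc, quad, he, inner_zero_right,
    div_mul_cancel₀ _ hne] at h
  linarith

lemma MSmooth.mact_mul_pinv_gradient {φ : Vec d → ℝ} {M D : Matrix (Fin d) (Fin d) ℝ}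
    (hM : MSmooth φ M) (hb : BddBelow (Set.range φ)) (hMt : Mᵀ = M) (hD : IsMoorePenrose M D)
    (x : Vec d) : mact (M * D) (gradient φ x) = gradient φ x := by
  set v := gradient φ x with hv
  obtain ⟨h1, h2, h3, h4⟩ := hD
  have hker : M * (M * D) = M := by
    have := congrArg Matrix.transpose h1
    rwa [Matrix.transpose_mul, h3, hMt] at this
  have he : mact M (v - mact (M * D) v) = 0 := by
    rw [mact_sub, ← mact_mul, hker, sub_self]
  have h5 := hM.inner_gradient_eq_zero hb x he
  have h6 : ⟪mact (M * D) v, v - mact (M * D) v⟫ = 0 := by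
    have e1 : mact (M * D) (v - mact (M * D) v) = 0 := by
      rw [mact_sub, ← mact_mul, ← Matrix.mul_assoc, h1, sub_self]
    have e2 := inner_mact_right (M * D) v (v - mact (M * D) v)
    rw [h3, e1, inner_zero_right] at e2
    exact e2.symm
  have h7 : ⟪v - mact (M * D) v, v - mact (M * D) v⟫ = 0 := by
    rw [inner_sub_left v, h5, h6, sub_zero]
  exact (sub_eq_zero.1 (inner_self_eq_zero.1 h7)).symm

lemma gradient_average {n : ℕ} {fi : Fin n → Vec d → ℝ} (hfi : ∀ i, Differentiable ℝ (fi i))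
    (x : Vec d) : gradient (fun x => (1 / (n : ℝ)) * ∑ i, fi i x) x
      = (1 / (n : ℝ)) • ∑ i, gradient (fi i) x := by
  refine HasGradientAt.gradient ?_
  rw [hasGradientAt_iff_hasFDerivAt]
  have h := (HasFDerivAt.fun_sum (u := Finset.univ)
    fun i _ => (hfi i x).hasGradientAt.hasFDerivAt).const_mul (1 / (n : ℝ))
  refine h.congr_fderiv ?_
  simp only [map_smul, map_sum]

end Smooth

section Prox

variable {d : ℕ}

lemma prox_variational {R : Vec d → EReal} (hR : ProperConvexLsc R) {c : ℝ} (hc : 0 < c)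
    {h : Vec d → ℝ} {u g : Vec d} {K : Vec d → ℝ}
    (hsm : ∀ v : Vec d, ∀ t : ℝ, h (u + t • v) ≤ h u + t * ⟪g, v⟫ + t ^ 2 * K v)
    (hu : ∀ w, (c : EReal) * R u + (h u : EReal) ≤ (c : EReal) * R w + (h w : EReal)) :
    R u ≠ ⊤ ∧ ∀ w, R w ≠ ⊤ → c * (R u).toReal ≤ c * (R w).toReal + ⟪g, w - u⟫ := by
  obtain ⟨hbot, ⟨w₀, hw₀⟩, hconv, -⟩ := hR
  have hutop : R u ≠ ⊤ := by
    intro htop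
    have h1 := hu w₀
    rw [htop, EReal.coe_mul_top_of_pos hc, EReal.top_add_coe, top_le_iff] at h1
    lift R w₀ to ℝ using ⟨hw₀, hbot w₀⟩ with r
    norm_cast at h1
    exact EReal.coe_ne_top _ h1
  refine ⟨hutop, fun w hw => ?_⟩
  have key : ∀ t : ℝ, 0 < t → t ≤ 1 →
      c * (R u).toReal - c * (R w).toReal - ⟪g, w - u⟫ ≤ t * K (w - u) := by
    intro t ht ht1
    have h1 := hu ((1 - t) • u + t • w)
    have h2 := hconv u w (1 - t) t (by linarith) ht.le (by ring)
    have h3 := hsm (w - u) t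
    have e : u + t • (w - u) = (1 - t) • u + t • w := by module
    rw [e] at h3
    have hp := hbot ((1 - t) • u + t • w)
    have hub := hbot u
    have hwb := hbot w
    generalize h ((1 - t) • u + t • w) = hp' at *
    generalize R ((1 - t) • u + t • w) = p at *
    generalize R u = ru at *
    generalize R w = rw' at *
    lift ru to ℝ using ⟨hutop, hub⟩
    lift rw' to ℝ using ⟨hw, hwb⟩
    have hpt : p ≠ ⊤ := by
      rintro rfl
      norm_cast at h2
    lift p to ℝ using ⟨hpt, hp⟩
    norm_cast at h1 h2
    simp only [EReal.toReal_coe]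
    have h4 : c * p ≤ c * ((1 - t) * ru + t * rw') := by gcongr
    refine le_of_mul_le_mul_left ?_ ht
    nlinarith
  have hlim : Filter.Tendsto (fun t : ℝ => t * K (w - u)) (nhdsWithin 0 (Set.Ioi 0)) (nhds 0) := by
    have : Filter.Tendsto (fun t : ℝ => t * K (w - u)) (nhds 0) (nhds (0 * K (w - u))) :=
      (continuous_id.mul continuous_const).tendsto 0
    rw [zero_mul] at this
    exact this.mono_left nhdsWithin_le_nhds
  have hfin := ge_of_tendsto hlim (by
    filter_upwards [Ioc_mem_nhdsGT (zero_lt_one (α := ℝ))] with t ht using key t ht.1 ht.2)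
  linarith

lemma norm_prox_sub_le {R : Vec d → EReal} (hR : ProperConvexLsc R) {γ : ℝ} (hγ : 0 < γ)
    {f : Vec d → ℝ} {M : Matrix (Fin d) (Fin d) ℝ} (hM : MSmooth f M) {xstar : Vec d}
    (hmin : ∀ x : Vec d, (f xstar : EReal) + R xstar ≤ (f x : EReal) + R x)
    {z u : Vec d} (hu : IsProxPt R γ z u) :
    ‖u - xstar‖ ≤ ‖z + γ • gradient f xstar - xstar‖ := by
  obtain ⟨hs1, hs2⟩ := prox_variational hR one_pos (h := f) (u := xstar)
    (g := gradient f xstar) (K := fun v => 1 / 2 * quad M v) (fun v t => by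
      have h := hM (xstar + t • v) xstar
      rw [add_sub_cancel_left, quad_smul, inner_smul_right] at h
      linarith) (fun w => by simpa [add_comm] using hmin w)
  obtain ⟨hu1, hu2⟩ := prox_variational hR hγ (h := fun w => 1 / 2 * ‖w - z‖ ^ 2) (u := u)
    (g := u - z) (K := fun v => 1 / 2 * ‖v‖ ^ 2) (fun v t => by
      have e : u + t • v - z = (u - z) + t • v := by abel
      rw [e, norm_add_sq_real, norm_smul, inner_smul_right, mul_pow, Real.norm_eq_abs, sq_abs]
      linarith) hu.1
  have h1 := hs2 u hu1
  have h2 := hu2 xstar hs1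
  have h3 : γ * ((R xstar).toReal) ≤ γ * ((R u).toReal + ⟪gradient f xstar, u - xstar⟫) := by
    gcongr
    linarith
  set a := z + γ • gradient f xstar - xstar with ha
  have e1 : u - z = (u - xstar) - a + γ • gradient f xstar := by rw [ha]; abel
  have e2 : xstar - u = -(u - xstar) := by abel
  rw [e1, e2, inner_neg_right, inner_add_left, inner_sub_left, inner_smul_left,
    real_inner_self_eq_norm_sq, conj_trivial] at h2
  have h4 : ‖u - xstar‖ ^ 2 ≤ ⟪a, u - xstar⟫ := by linarith
  have h5 := real_inner_le_norm a (u - xstar)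
  by_contra! hlt
  nlinarith [norm_nonneg a, norm_nonneg (u - xstar)]

end Prox

section Expectation

lemma sum_pi_prod_eq_one {Ω : Type*} [Fintype Ω] {n : ℕ} (p : Fin n → Ω → ℝ)
    (hp : ∀ i, ∑ s, p i s = 1) : ∑ ω : Fin n → Ω, ∏ i, p i (ω i) = 1 := by
  rw [← Fintype.piFinset_univ, ← Finset.prod_univ_sum]
  simp [hp]

lemma sum_mul_norm_add_sq {V Ω : Type*} [NormedAddCommGroup V] [InnerProductSpace ℝ V] [Fintype Ω]
    (p : Ω → ℝ) (hp : ∑ s, p s = 1) (h : Ω → V) (hh : ∑ s, p s • h s = 0) (a : V) :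
    ∑ s, p s * ‖a + h s‖ ^ 2 = ‖a‖ ^ 2 + ∑ s, p s * ‖h s‖ ^ 2 := by
  have h1 : ∑ s, p s * (2 * ⟪a, h s⟫) = 0 := by
    calc ∑ s, p s * (2 * ⟪a, h s⟫) = 2 * ⟪a, ∑ s, p s • h s⟫ := by
          rw [inner_sum, Finset.mul_sum]
          exact Finset.sum_congr rfl fun s _ => by rw [inner_smul_right]; ring
      _ = 0 := by rw [hh, inner_zero_right, mul_zero]
  simp only [norm_add_sq_real, mul_add, Finset.sum_add_distrib, ← Finset.sum_mul, hp, one_mul]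
  rw [h1, add_zero]

/-- Bias-variance decomposition for a sum of independent centered vectors. -/
lemma sum_pi_mul_norm_add_sum_sq {V Ω : Type*} [NormedAddCommGroup V] [InnerProductSpace ℝ V]
    [Fintype Ω] : ∀ {n : ℕ} (p : Fin n → Ω → ℝ) (_ : ∀ i, ∑ s, p i s = 1) (h : Fin n → Ω → V)
    (_ : ∀ i, ∑ s, p i s • h i s = 0) (a : V),
    ∑ ω : Fin n → Ω, (∏ i, p i (ω i)) * ‖a + ∑ i, h i (ω i)‖ ^ 2
      = ‖a‖ ^ 2 + ∑ i, ∑ s, p i s * ‖h i s‖ ^ 2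
  | 0, p, _, h, _, a => by simp
  | n + 1, p, hp, h, hh, a => by
    rw [← (Fin.consEquiv fun _ => Ω).sum_comp, Fintype.sum_prod_type]
    have key : ∀ s : Ω, ∑ ω : Fin n → Ω,
        (∏ i, p i (Fin.consEquiv (fun _ => Ω) (s, ω) i)) *
          ‖a + ∑ i, h i (Fin.consEquiv (fun _ => Ω) (s, ω) i)‖ ^ 2
        = p 0 s * ‖a + h 0 s‖ ^ 2
          + p 0 s * ∑ i : Fin n, ∑ s, p i.succ s * ‖h i.succ s‖ ^ 2 := by
      intro s
      rw [← mul_add, ← sum_pi_mul_norm_add_sum_sq (fun i => p i.succ) (fun i => hp i.succ)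
        (fun i => h i.succ) (fun i => hh i.succ) (a + h 0 s), Finset.mul_sum]
      refine Finset.sum_congr rfl fun ω _ => ?_
      simp [Fin.consEquiv, Fin.prod_univ_succ, Fin.sum_univ_succ, mul_assoc, add_assoc]
    simp only [key]
    rw [Finset.sum_add_distrib, sum_mul_norm_add_sq _ (hp 0) _ (hh 0), ← Finset.sum_mul, hp 0,
      one_mul, Fin.sum_univ_succ, add_assoc]

lemma trajExp_le_of_step_le {V Ω : Type*} [Fintype Ω] {P : Ω → ℝ} (hP : ∀ s, 0 ≤ P s)
    (hP1 : ∑ s, P s = 1) {x0 : V} {step : V → Ω → V} {φ : V → ℝ} {q b B : ℝ} (hq : 0 ≤ q)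
    (hstep : ∀ x, ∑ s, P s * φ (step x s) ≤ q * φ x + b) (hB : 0 ≤ B) (hbB : q * B + b ≤ B)
    (k : ℕ) : trajExp P x0 step φ k ≤ q ^ k * φ x0 + B := by
  induction k with
  | zero => simpa [trajExp, traj] using hB
  | succ k ih =>
    have hrec : trajExp P x0 step φ (k + 1) ≤ q * trajExp P x0 step φ k + b := by
      unfold trajExp
      rw [← (Fin.snocEquiv fun _ => Ω).sum_comp, Fintype.sum_prod_type_right]
      have hsum : ∑ ω : Fin k → Ω, ∏ i, P (ω i) = 1 :=
        sum_pi_prod_eq_one (fun _ => P) fun _ => hP1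
      calc _ = ∑ ω : Fin k → Ω, (∏ i, P (ω i)) * ∑ s, P s * φ (step (traj x0 step k ω) s) := by
            refine Finset.sum_congr rfl fun ω _ => ?_
            rw [Finset.mul_sum]
            refine Finset.sum_congr rfl fun s _ => ?_
            simp [Fin.snocEquiv, Fin.prod_univ_castSucc, traj, mul_assoc]
        _ ≤ ∑ ω : Fin k → Ω, (∏ i, P (ω i)) * (q * φ (traj x0 step k ω) + b) := by
            refine Finset.sum_le_sum fun ω _ => mul_le_mul_of_nonneg_left (hstep _) ?_
            exact Finset.prod_nonneg fun i _ => hP _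
        _ = _ := by
            simp only [mul_add, Finset.sum_add_distrib, ← Finset.sum_mul, hsum, one_mul]
            rw [Finset.mul_sum]
            congr 1
            exact Finset.sum_congr rfl fun ω _ => by ring
    calc _ ≤ q * trajExp P x0 step φ k + b := hrec
      _ ≤ q * (q ^ k * φ x0 + B) + b := by gcongr
      _ ≤ q ^ (k + 1) * φ x0 + B := by rw [pow_succ']; linarith

end Expectation

namespace Sampling

variable {d : ℕ} (μ : Sampling d)

lemma marg_pos (j : Fin d) : 0 < μ.marg j := μ.margPos j

lemma sum_prob_mul_coeff (j : Fin d) :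
    ∑ S, μ.prob S * (if j ∈ S then (μ.marg j)⁻¹ else 0) = 1 := by
  have h : ∀ S, μ.prob S * (if j ∈ S then (μ.marg j)⁻¹ else 0)
      = (if j ∈ S then μ.prob S else 0) * (μ.marg j)⁻¹ := fun S => by split_ifs <;> simp
  rw [Finset.sum_congr rfl fun S _ => h S, ← Finset.sum_mul]
  exact mul_inv_cancel₀ (μ.marg_pos j).ne'

lemma sum_prob_mul_coeff_mul_coeff (j l : Fin d) :
    ∑ S, μ.prob S * ((if j ∈ S then (μ.marg j)⁻¹ else 0) * (if l ∈ S then (μ.marg l)⁻¹ else 0))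
      = μ.Pbar j l := by
  have h : ∀ S, μ.prob S *
      ((if j ∈ S then (μ.marg j)⁻¹ else 0) * (if l ∈ S then (μ.marg l)⁻¹ else 0))
      = (if j ∈ S ∧ l ∈ S then μ.prob S else 0) / (μ.marg j * μ.marg l) := fun S => by
    by_cases h1 : j ∈ S <;> by_cases h2 : l ∈ S <;> simp [h1, h2, div_eq_mul_inv, mul_comm]
  rw [Finset.sum_congr rfl fun S _ => h S, ← Finset.sum_div]
  rfl

lemma sum_prob_mul_coeff_sub_one (j l : Fin d) :
    ∑ S, μ.prob S * (((if j ∈ S then (μ.marg j)⁻¹ else 0) - 1)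
        * ((if l ∈ S then (μ.marg l)⁻¹ else 0) - 1)) = μ.Ptilde j l := by
  have h : ∀ a b c : ℝ, c * ((a - 1) * (b - 1)) = c * (a * b) - c * a - c * b + c :=
    fun a b c => by ring
  simp only [h, Finset.sum_add_distrib, Finset.sum_sub_distrib, sum_prob_mul_coeff,
    sum_prob_mul_coeff_mul_coeff, μ.total, Ptilde, Matrix.sub_apply, Matrix.of_apply]
  ring

lemma mact_sketch_sub_one_apply (S : Finset (Fin d)) (w : Vec d) (j : Fin d) :
    mact (μ.sketch S - 1) w j = ((if j ∈ S then (μ.marg j)⁻¹ else 0) - 1) * w j := by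
  rw [mact_sub_left, mact_one]
  simp [mact, sketch, Matrix.mulVec_diagonal, sub_mul]

lemma sum_prob_smul_mact_sketch_sub_one (w : Vec d) :
    ∑ S, μ.prob S • mact (μ.sketch S - 1) w = 0 := by
  ext j
  simp only [WithLp.ofLp_sum, Finset.sum_apply, PiLp.smul_apply, mact_sketch_sub_one_apply,
    smul_eq_mul, ← mul_assoc, ← Finset.sum_mul, PiLp.zero_apply]
  simp only [mul_sub, Finset.sum_sub_distrib, sum_prob_mul_coeff, mul_one, μ.total]
  simp

lemma sum_prob_mul_quad_sketch_sub_one (L : Matrix (Fin d) (Fin d) ℝ) (w : Vec d) :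
    ∑ S, μ.prob S * quad L (mact (μ.sketch S - 1) w) = quad (μ.Ptilde.hadamard L) w := by
  simp only [quad_eq_dotProduct, dotProduct, Matrix.mulVec, Finset.mul_sum,
    mact_sketch_sub_one_apply, Matrix.hadamard_apply, ← sum_prob_mul_coeff_sub_one,
    Finset.sum_mul]
  rw [Finset.sum_comm]
  refine Finset.sum_congr rfl fun j _ => ?_
  rw [Finset.sum_comm]
  refine Finset.sum_congr rfl fun l _ => Finset.sum_congr rfl fun S _ => ?_
  ring

lemma quad_hadamard_nonneg {L : Matrix (Fin d) (Fin d) ℝ} (hL : L.PosSemidef) (w : Vec d) :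
    0 ≤ quad (μ.Ptilde.hadamard L) w := by
  rw [← sum_prob_mul_quad_sketch_sub_one]
  exact Finset.sum_nonneg fun S _ => mul_nonneg (μ.nonneg S) (quad_nonneg hL _)

end Sampling

section SketchedGradient

variable {d : ℕ}

lemma mu_le_lambdaMax (hd : 0 < d) {f : Vec d → ℝ} {M : Matrix (Fin d) (Fin d) ℝ}
    (hM : MSmooth f M) {mu : ℝ}
    (hsc : ∀ x y : Vec d, f y + ⟪gradient f y, x - y⟫ + mu / 2 * ‖x - y‖ ^ 2 ≤ f x) :
    mu ≤ lambdaMax M := by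
  set v : Vec d := EuclideanSpace.single ⟨0, hd⟩ 1 with hv
  have hv1 : ‖v‖ = 1 := by simp [hv]
  have h1 := hM v 0
  have h2 := hsc v 0
  have h3 := quad_le_lambdaMax M v
  rw [sub_zero] at h1 h2
  rw [hv1] at h2 h3
  linarith

lemma lambdaMax_of_dim_zero (M : Matrix (Fin 0) (Fin 0) ℝ) : lambdaMax M = 0 := by
  simp [lambdaMax]

lemma mact_sketch_of_mact_eq (μ : Sampling d) {A B : Matrix (Fin d) (Fin d) ℝ} {v : Vec d}
    (hv : mact (A * B) v = v) (S : Finset (Fin d)) :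
    mact (A * μ.sketch S * B) v = v + mact A (mact (μ.sketch S - 1) (mact B v)) := by
  rw [mact_sub_left, mact_one, mact_sub, ← mact_mul A B, hv, mact_mul, mact_mul]
  abel

lemma sum_prob_mul_norm_sketch_error_sq_le (μ : Sampling d) {L S D T : Matrix (Fin d) (Fin d) ℝ}
    (hS : S.PosSemidef ∧ S * S = L) (hT : T.PosSemidef ∧ T * T = D) (c : ℝ) (v : Vec d) :
    ∑ s, μ.prob s * ‖c • mact S (mact (μ.sketch s - 1) (mact T v))‖ ^ 2
      ≤ c ^ 2 * (lambdaMax (Matrix.hadamard μ.Ptilde L) * quad D v) := by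
  have h : ∀ s, μ.prob s * ‖c • mact S (mact (μ.sketch s - 1) (mact T v))‖ ^ 2
      = c ^ 2 * (μ.prob s * quad L (mact (μ.sketch s - 1) (mact T v))) := fun s => by
    rw [← hS.2, quad_mul_self hS.1, norm_smul, mul_pow, Real.norm_eq_abs, sq_abs]
    ring
  rw [Finset.sum_congr rfl fun s _ => h s, ← Finset.mul_sum,
    μ.sum_prob_mul_quad_sketch_sub_one, ← hT.2, quad_mul_self hT.1]
  gcongr
  exact quad_le_lambdaMax _ _

lemma norm_gradient_step_sq_le {f : Vec d → ℝ} {M : Matrix (Fin d) (Fin d) ℝ}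
    (hM : MSmooth f M) (hpos : 0 < lambdaMax M) {mu : ℝ} (hmu : 0 < mu)
    (hsc : ∀ x y : Vec d, f y + ⟪gradient f y, x - y⟫ + mu / 2 * ‖x - y‖ ^ 2 ≤ f x)
    {γ : ℝ} (hγ : 0 < γ) (x y : Vec d) :
    ‖x - γ • gradient f x + γ • gradient f y - y‖ ^ 2
      ≤ (1 - γ * mu) * ‖x - y‖ ^ 2 - 2 * γ * (1 - γ * lambdaMax M) * bregman f x y := by
  have e : x - γ • gradient f x + γ • gradient f y - y
      = (x - y) - γ • (gradient f x - gradient f y) := by module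
  have hconv : ∀ x y, f y + ⟪gradient f y, x - y⟫ ≤ f x := fun x y => by
    nlinarith [hsc x y, sq_nonneg ‖x - y‖]
  have h1 := hM.norm_sq_le_bregman hconv hpos x y
  have h2 := hsc y x
  have e2 : y - x = -(x - y) := by abel
  rw [e2, inner_neg_right, norm_neg] at h2
  rw [e, norm_sub_sq_real, norm_smul, inner_smul_right, mul_pow, Real.norm_eq_abs, sq_abs,
    inner_sub_right, real_inner_comm (gradient f x), real_inner_comm (gradient f y)]
  have h3 : bregman f x y + mu / 2 * ‖x - y‖ ^ 2
      ≤ ⟪gradient f x, x - y⟫ - ⟪gradient f y, x - y⟫ := by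
    rw [bregman]
    linarith
  nlinarith [mul_le_mul_of_nonneg_left h1 (sq_nonneg γ), mul_le_mul_of_nonneg_left h3 hγ.le]

lemma bregman_average {n : ℕ} {fi : Fin n → Vec d → ℝ} (hfi : ∀ i, Differentiable ℝ (fi i))
    (x y : Vec d) : bregman (fun x => (1 / (n : ℝ)) * ∑ i, fi i x) x y
      = (1 / (n : ℝ)) * ∑ i, bregman (fi i) x y := by
  simp only [bregman, gradient_average hfi, inner_smul_left, sum_inner, conj_trivial,
    Finset.sum_sub_distrib, mul_sub]

lemma expected_sketch_variance_le {n : ℕ} {μs : Fin n → Sampling d} {fi : Fin n → Vec d → ℝ}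
    {Li Lih Lidag Lidh : Fin n → Matrix (Fin d) (Fin d) ℝ}
    (hLi : ∀ i, (Li i).PosSemidef)
    (hfi : ∀ i, Differentiable ℝ (fi i) ∧ ConvexOn ℝ Set.univ (fi i) ∧
      BddBelow (Set.range (fi i)) ∧ MSmooth (fi i) (Li i))
    (hLih : ∀ i, (Lih i).PosSemidef ∧ Lih i * Lih i = Li i)
    (hLidag : ∀ i, IsMoorePenrose (Li i) (Lidag i))
    (hLidh : ∀ i, (Lidh i).PosSemidef ∧ Lidh i * Lidh i = Lidag i) {c Lmax : ℝ}
    (hLmax : ∀ i, lambdaMax (Matrix.hadamard (μs i).Ptilde (Li i)) ≤ Lmax) (x y : Vec d) :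
    ∑ i, ∑ s, (μs i).prob s *
        ‖c • mact (Lih i) (mact ((μs i).sketch s - 1) (mact (Lidh i) (gradient (fi i) x)))‖ ^ 2
      ≤ c ^ 2 * (4 * Lmax * ∑ i, bregman (fi i) x y
        + 2 * ∑ i, lambdaMax (Matrix.hadamard (μs i).Ptilde (Li i))
          * quad (Lidag i) (gradient (fi i) y)) := by
  rw [Finset.mul_sum, Finset.mul_sum, ← Finset.sum_add_distrib, Finset.mul_sum]
  refine Finset.sum_le_sum fun i _ => ?_
  refine (sum_prob_mul_norm_sketch_error_sq_le (μs i) (hLih i) (hLidh i) c _).trans ?_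
  obtain ⟨hd, hc, -, hM⟩ := hfi i
  have hDt : (Lidag i)ᵀ = Lidag i := by
    rw [← (hLidh i).2, Matrix.transpose_mul, transpose_eq_of_posSemidef (hLidh i).1]
  have hconv := hc.add_inner_gradient_le hd
  have h1 := hM.quad_pinv_le_bregman hconv (hLidag i).2.1 hDt x y
  have h2 := quad_sub_le_of_mul_self (hLidh i) (gradient (fi i) x) (gradient (fi i) y)
  have h3 : 0 ≤ bregman (fi i) x y := by
    rw [bregman]
    linarith [hconv x y]
  have h4 := lambdaMax_nonneg ((μs i).quad_hadamard_nonneg (hLi i))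
  gcongr
  calc _ ≤ lambdaMax (Matrix.hadamard (μs i).Ptilde (Li i)) *
        (4 * bregman (fi i) x y + 2 * quad (Lidag i) (gradient (fi i) y)) := by
        gcongr
        linarith
    _ ≤ _ := by nlinarith [mul_le_mul_of_nonneg_right (hLmax i) h3]

end SketchedGradient

/-- DCGD+ convergence (Theorem `thm:dist-prox-skgd-better`). -/
theorem statement8 {d n : ℕ} (hn : 0 < n) (μs : Fin n → Sampling d)
    (fi : Fin n → Vec d → ℝ) (Li Lih Lidag Lidh : Fin n → Matrix (Fin d) (Fin d) ℝ)
    (hLi : ∀ i, (Li i).PosSemidef)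
    (hfi : ∀ i, Differentiable ℝ (fi i) ∧ ConvexOn ℝ Set.univ (fi i) ∧
      BddBelow (Set.range (fi i)) ∧ MSmooth (fi i) (Li i))
    (hLih : ∀ i, (Lih i).PosSemidef ∧ Lih i * Lih i = Li i)
    (hLidag : ∀ i, IsMoorePenrose (Li i) (Lidag i))
    (hLidh : ∀ i, (Lidh i).PosSemidef ∧ Lidh i * Lidh i = Lidag i)
    (f : Vec d → ℝ) (hf : f = fun x => (1 / (n : ℝ)) * ∑ i, fi i x)
    (LL : Matrix (Fin d) (Fin d) ℝ) (hLL : LL.PosSemidef) (hfLL : MSmooth f LL)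
    (mu : ℝ) (hmu : 0 < mu)
    (hsc : ∀ x y : Vec d, f y + ⟪gradient f y, x - y⟫ + mu / 2 * ‖x - y‖ ^ 2 ≤ f x)
    (R : Vec d → EReal) (hR : ProperConvexLsc R)
    (xstar : Vec d) (hmin : ∀ x : Vec d, (f xstar : EReal) + R xstar ≤ (f x : EReal) + R x)
    (Ltilmax : ℝ) (hLtilmax : Ltilmax = ⨆ i, lambdaMax (Matrix.hadamard (μs i).Ptilde (Li i)))
    (γ : ℝ) (hγ : 0 < γ) (hγ' : γ ≤ 1 / (lambdaMax LL + 2 / (n : ℝ) * Ltilmax))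
    (proxR : Vec d → Vec d) (hprox : ∀ z : Vec d, IsProxPt R γ z (proxR z))
    (σstar : ℝ)
    (hσstar : σstar = (1 / (n : ℝ)) * ∑ i, lambdaMax (Matrix.hadamard (μs i).Ptilde (Li i))
        * quad (Lidag i) (gradient (fi i) xstar))
    (x0 : Vec d) :
    ∀ k : ℕ,
      trajExp (fun ω : Fin n → Finset (Fin d) => ∏ i, (μs i).prob (ω i)) x0
          (fun x ω => proxR (x - γ • ((1 / (n : ℝ)) •
            ∑ i, mact (Lih i * (μs i).sketch (ω i) * Lidh i) (gradient (fi i) x))))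
          (fun x => ‖x - xstar‖ ^ 2) k
        ≤ (1 - γ * mu) ^ k * ‖x0 - xstar‖ ^ 2 + 2 * γ * σstar / (mu * n) := by
  have hn' : (0 : ℝ) < n := Nat.cast_pos.2 hn
  have hLle : ∀ i, lambdaMax (Matrix.hadamard (μs i).Ptilde (Li i)) ≤ Ltilmax := fun i => by
    rw [hLtilmax]
    exact le_ciSup (f := fun i => lambdaMax (Matrix.hadamard (μs i).Ptilde (Li i)))
      (Set.finite_range _).bddAbove i
  have hLnn : ∀ i, 0 ≤ lambdaMax (Matrix.hadamard (μs i).Ptilde (Li i)) := fun i =>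
    lambdaMax_nonneg ((μs i).quad_hadamard_nonneg (hLi i))
  have hLmax0 : 0 ≤ Ltilmax := (hLnn ⟨0, hn⟩).trans (hLle _)
  have hd : 0 < d := by
    rcases Nat.eq_zero_or_pos d with rfl | h
    · simp only [lambdaMax_of_dim_zero, Real.iSup_const_zero] at hLtilmax
      rw [hLtilmax, lambdaMax_of_dim_zero, mul_zero, add_zero, div_zero] at hγ'
      linarith
    · exact h
  have hmuL := mu_le_lambdaMax hd hfLL hsc
  have hLpos : 0 < lambdaMax LL := hmu.trans_le hmuL
  have hγA : γ * (lambdaMax LL + 2 / (n : ℝ) * Ltilmax) ≤ 1 :=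
    (le_div_iff₀ (by positivity)).1 hγ'
  have hq : 0 ≤ 1 - γ * mu := by
    have : γ * mu ≤ γ * (lambdaMax LL + 2 / (n : ℝ) * Ltilmax) := by
      have : 0 ≤ 2 / (n : ℝ) * Ltilmax := by positivity
      gcongr
      linarith
    linarith
  have hσ0 : 0 ≤ σstar := by
    rw [hσstar]
    refine mul_nonneg (by positivity) (Finset.sum_nonneg fun i _ => mul_nonneg (hLnn i) ?_)
    rw [← (hLidh i).2, quad_mul_self (hLidh i).1]
    positivity
  have hgrad : ∀ x, gradient f x = (1 / (n : ℝ)) • ∑ i, gradient (fi i) x := fun x => by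
    rw [hf, gradient_average fun i => (hfi i).1]
  refine trajExp_le_of_step_le (b := 2 * γ ^ 2 * σstar / n)
    (fun ω => Finset.prod_nonneg fun i _ => (μs i).nonneg _)
    (sum_pi_prod_eq_one _ fun i => (μs i).total) hq (fun x => ?_) (by positivity) ?_
  · set a := x - γ • gradient f x + γ • gradient f xstar - xstar with ha
    set h : Fin n → Finset (Fin d) → Vec d := fun i s => (-(γ / n)) •
      mact (Lih i) (mact ((μs i).sketch s - 1) (mact (Lidh i) (gradient (fi i) x))) with hh
    have hz : ∀ ω : Fin n → Finset (Fin d), x - γ • ((1 / (n : ℝ)) •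
        ∑ i, mact (Lih i * (μs i).sketch (ω i) * Lidh i) (gradient (fi i) x))
          + γ • gradient f xstar - xstar = a + ∑ i, h i (ω i) := fun ω => by
      have hproj : ∀ i, mact (Lih i * Lidh i) (gradient (fi i) x) = gradient (fi i) x := fun i => by
        rw [sqrt_mul_sqrt_pinv (hLih i) (hLidag i) (hLidh i)]
        exact (hfi i).2.2.2.mact_mul_pinv_gradient (hfi i).2.2.1
          (transpose_eq_of_posSemidef (hLi i)) (hLidag i) x
      simp only [ha, hh, hgrad x, mact_sketch_of_mact_eq _ (hproj _), Finset.sum_add_distrib,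
        ← Finset.smul_sum]
      module
    have hmean : ∀ i, ∑ s, (μs i).prob s • h i s = 0 := fun i => by
      have h1 : ∀ s, (μs i).prob s • h i s = (-(γ / n)) • mact (Lih i)
          ((μs i).prob s • mact ((μs i).sketch s - 1) (mact (Lidh i) (gradient (fi i) x))) :=
        fun s => by rw [mact_smul, smul_comm]
      rw [Finset.sum_congr rfl fun s _ => h1 s, ← Finset.smul_sum]
      have h2 := map_sum (Matrix.toEuclideanLin (Lih i)) (fun s => (μs i).prob s •
        mact ((μs i).sketch s - 1) (mact (Lidh i) (gradient (fi i) x))) Finset.univ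
      rw [(μs i).sum_prob_smul_mact_sketch_sub_one, map_zero] at h2
      simp only [mact] at h2 ⊢
      rw [← h2, smul_zero]
    have hvar := expected_sketch_variance_le (c := -(γ / n)) hLi hfi hLih hLidag hLidh hLle x xstar
    have hstep := norm_gradient_step_sq_le hfLL hLpos hmu hsc hγ x xstar
    have hbreg : ∑ i, bregman (fi i) x xstar = n * bregman f x xstar := by
      rw [hf, bregman_average fun i => (hfi i).1]
      field_simp
    have hσ : ∑ i, lambdaMax (Matrix.hadamard (μs i).Ptilde (Li i))
        * quad (Lidag i) (gradient (fi i) xstar) = n * σstar := by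
      rw [hσstar]
      field_simp
    have hB : 0 ≤ bregman f x xstar := by
      rw [bregman]
      nlinarith [hsc x xstar, sq_nonneg ‖x - xstar‖]
    rw [hbreg, hσ] at hvar
    calc _ ≤ ∑ ω : Fin n → Finset (Fin d),
            (∏ i, (μs i).prob (ω i)) * ‖a + ∑ i, h i (ω i)‖ ^ 2 := by
          refine Finset.sum_le_sum fun ω _ => mul_le_mul_of_nonneg_left ?_
            (Finset.prod_nonneg fun i _ => (μs i).nonneg _)
          rw [← hz ω]
          gcongr
          exact norm_prox_sub_le hR hγ hfLL hmin (hprox _)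
      _ = ‖a‖ ^ 2 + ∑ i, ∑ s, (μs i).prob s * ‖h i s‖ ^ 2 :=
          sum_pi_mul_norm_add_sum_sq _ (fun i => (μs i).total) _ hmean a
      _ ≤ ((1 - γ * mu) * ‖x - xstar‖ ^ 2
            - 2 * γ * (1 - γ * lambdaMax LL) * bregman f x xstar)
          + (-(γ / n)) ^ 2 * (4 * Ltilmax * (n * bregman f x xstar) + 2 * (n * σstar)) :=
          add_le_add hstep hvar
      _ = (1 - γ * mu) * ‖x - xstar‖ ^ 2 + 2 * γ ^ 2 * σstar / n - 2 * γ *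
          ((1 - γ * (lambdaMax LL + 2 / (n : ℝ) * Ltilmax)) * bregman f x xstar) := by
          field_simp
          ring
      _ ≤ _ := by
          have := mul_nonneg (sub_nonneg.2 hγA) hB
          have := mul_nonneg hγ.le this
          linarith
  · refine le_of_eq ?_
    field_simp
    ring
end
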